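/- arXiv:2305.08516 — 9 statements merged into one kernel-verified Lean document; each statement's English description precedes it below -/
import Mathlib

section
/- Let n ≥ 3 be an integer, let m > 0, λ, β ∈ ℝ, A > 0, let I ⊆ ℝ be an open interval, and let f : I → ℝ be three times continuously differentiable. Suppose that for all t ∈ I: (F1) (f'(t))² = 2m·(f''(t) − (n−1)λ), and (F2) 0 = β − (A²/(n−1))·e^{−2f(t)/(n−1)}·(2(n−1)²λ + (f'(t))² − f''(t)). Then for all t ∈ I: m·f'''(t) = f'(t)·f''(t), and f'(t)·( 4m(m−n+1)(n−1)λ − (4m² − 2mn + n − 1)·f''(t) ) = 0. -/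
/-- Differentiating equations (3.8) and (3.7) of the paper yields equation (3.9). -/
theorem stmt_3 (n : ℕ) (hn : 3 ≤ n) (m lam β : ℝ) (hm : 0 < m) (A : ℝ) (hA : 0 < A)
    (I : Set ℝ) (hIopen : IsOpen I) (hIconn : I.OrdConnected)
    (f f' f'' f''' : ℝ → ℝ)
    (hf : ∀ t ∈ I, HasDerivAt f (f' t) t)
    (hf' : ∀ t ∈ I, HasDerivAt f' (f'' t) t)
    (hf'' : ∀ t ∈ I, HasDerivAt f'' (f''' t) t)
    (hF1 : ∀ t ∈ I, (f' t) ^ 2 = 2 * m * (f'' t - ((n : ℝ) - 1) * lam))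
    (hF2 : ∀ t ∈ I, 0 = β - (A ^ 2 / ((n : ℝ) - 1)) *
      Real.exp (-2 * f t / ((n : ℝ) - 1)) *
      (2 * ((n : ℝ) - 1) ^ 2 * lam + (f' t) ^ 2 - f'' t)) :
    ∀ t ∈ I, m * f''' t = f' t * f'' t ∧
      f' t * (4 * m * (m - (n : ℝ) + 1) * ((n : ℝ) - 1) * lam
        - (4 * m ^ 2 - 2 * m * (n : ℝ) + (n : ℝ) - 1) * f'' t) = 0 := by
  intro t ht
  have hN : (0 : ℝ) < (n : ℝ) - 1 := by
    have : (3 : ℝ) ≤ n := by exact_mod_cast hn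
    linarith
  generalize hNe : (n : ℝ) - 1 = N at *
  have hn' : (n : ℝ) = N + 1 := by linarith
  have hnhds : I ∈ nhds t := hIopen.mem_nhds ht
  have d0 := hf t ht
  have d1 := hf' t ht
  have d2 := hf'' t ht
  have e1 : (fun s => (f' s) ^ 2) =ᶠ[nhds t] fun s => 2 * m * (f'' s - N * lam) := by
    filter_upwards [hnhds] with s hs using hF1 s hs
  have h1 := (d1.pow 2).unique
    (((d2.sub_const (N * lam)).const_mul (2 * m)).congr_of_eventuallyEq e1)
  have k1 : m * f''' t = f' t * f'' t := by
    norm_num at h1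
    linarith
  refine ⟨k1, ?_⟩
  have e2 : (fun s => (A ^ 2 / N) * (Real.exp (-2 * f s / N) *
      (2 * N ^ 2 * lam + (f' s) ^ 2 - f'' s))) =ᶠ[nhds t] fun _ => β := by
    filter_upwards [hnhds] with s hs
    have := hF2 s hs
    linarith
  have hE := ((d0.const_mul (-2)).div_const N).exp
  have hP := ((d1.pow 2).const_add (2 * N ^ 2 * lam)).sub d2
  have h2 := ((hE.mul hP).const_mul (A ^ 2 / N)).unique
    ((hasDerivAt_const t β).congr_of_eventuallyEq e2)
  have h3 : -2 * f' t / N * (2 * N ^ 2 * lam + (f' t) ^ 2 - f'' t)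
      + (2 * f' t * f'' t - f''' t) = 0 := by
    have hc : A ^ 2 / N * Real.exp (-2 * f t / N) ≠ 0 := by positivity
    apply (mul_eq_zero.mp _).resolve_left hc
    rw [← h2]
    simp
    ring
  have h4 : -2 * f' t * (2 * N ^ 2 * lam + (f' t) ^ 2 - f'' t)
      + N * (2 * f' t * f'' t - f''' t) = 0 := by
    field_simp at h3
    linarith
  have h5 := hF1 t ht
  rw [h5] at h4
  rw [hn']
  linear_combination m * h4 + N * k1
end

section
/- Let n ≥ 3 be an integer, let m > 0 with (2m−1)(2m−(n−1)) ≠ 0, let λ, β ∈ ℝ and A > 0, let I ⊆ ℝ be a nonempty open interval, and let f : I → ℝ be three times continuously differentiable with f'(t) ≠ 0 for all t ∈ I. Suppose that for all t ∈ I: (F1) (f'(t))² = 2m·(f''(t) − (n−1)λ), (F2) 0 = β − (A²/(n−1))·e^{−2f(t)/(n−1)}·(2(n−1)²λ + (f'(t))² − f''(t)), and (G) f'(t)·( 4m(m−n+1)(n−1)λ − (4m² − 2mn + n − 1)·f''(t) ) = 0. Then m = n−1, λ < 0, f''(t) = 0 for all t ∈ I, and (f'(t))² = −2(n−1)²λ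 for all t ∈ I. -/
/-- The case m ∉ {1/2, (n-1)/2} in the proof of Theorem 1.2 of the paper. -/
theorem stmt_4 (n : ℕ) (hn : 3 ≤ n) (m : ℝ) (hm : 0 < m)
    (hmexc : (2 * m - 1) * (2 * m - ((n : ℝ) - 1)) ≠ 0)
    (lam β : ℝ) (A : ℝ) (hA : 0 < A)
    (I : Set ℝ) (hIopen : IsOpen I) (hIconn : I.OrdConnected) (hIne : I.Nonempty)
    (f f' f'' f''' : ℝ → ℝ)
    (hf : ∀ t ∈ I, HasDerivAt f (f' t) t)
    (hf' : ∀ t ∈ I, HasDerivAt f' (f'' t) t)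
    (hf'' : ∀ t ∈ I, HasDerivAt f'' (f''' t) t)
    (hf'ne : ∀ t ∈ I, f' t ≠ 0)
    (hF1 : ∀ t ∈ I, (f' t) ^ 2 = 2 * m * (f'' t - ((n : ℝ) - 1) * lam))
    (hF2 : ∀ t ∈ I, 0 = β - (A ^ 2 / ((n : ℝ) - 1)) *
      Real.exp (-2 * f t / ((n : ℝ) - 1)) *
      (2 * ((n : ℝ) - 1) ^ 2 * lam + (f' t) ^ 2 - f'' t))
    (hG : ∀ t ∈ I, f' t * (4 * m * (m - (n : ℝ) + 1) * ((n : ℝ) - 1) * lam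
      - (4 * m ^ 2 - 2 * m * (n : ℝ) + (n : ℝ) - 1) * f'' t) = 0) :
    m = (n : ℝ) - 1 ∧ lam < 0 ∧ (∀ t ∈ I, f'' t = 0) ∧
      ∀ t ∈ I, (f' t) ^ 2 = -2 * ((n : ℝ) - 1) ^ 2 * lam := by
  have hn' : (0 : ℝ) < (n : ℝ) - 1 := by
    have : (3 : ℝ) ≤ n := by exact_mod_cast hn
    linarith
  have hD : 4 * m ^ 2 - 2 * m * (n : ℝ) + (n : ℝ) - 1 ≠ 0 := by
    intro h
    apply hmexc
    linarith
  have hc : ∀ t ∈ I, f'' t = 4 * m * (m - (n : ℝ) + 1) * ((n : ℝ) - 1) * lam /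
      (4 * m ^ 2 - 2 * m * (n : ℝ) + (n : ℝ) - 1) := by
    intro t ht
    rw [eq_div_iff hD]
    have := (mul_eq_zero.mp (hG t ht)).resolve_left (hf'ne t ht)
    linarith
  have h0 : ∀ t ∈ I, f'' t = 0 := by
    intro t ht
    have h1 : HasDerivAt (fun s => (f' s) ^ 2) (2 * f' t * f'' t) t := by
      have := (hf' t ht).fun_pow 2
      have e : 2 * f' t * f'' t = ((2 : ℕ) : ℝ) * f' t ^ (2 - 1) * f'' t := by norm_num
      rw [e]
      exact this
    have h2 : HasDerivAt (fun s => (f' s) ^ 2) 0 t := by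
      apply (hasDerivAt_const t ((f' t) ^ 2)).congr_of_eventuallyEq
      filter_upwards [hIopen.mem_nhds ht] with s hs
      rw [hF1 s hs, hF1 t ht, hc s hs, hc t ht]
    have h3 := h1.unique h2
    have h4 := hf'ne t ht
    simpa [h4] using h3
  obtain ⟨t, ht⟩ := hIne
  have hpos : 0 < (f' t) ^ 2 := by
    have := hf'ne t ht
    positivity
  have hlam : lam < 0 := by
    by_contra hl
    push Not at hl
    have h1 := hF1 t ht
    rw [h0 t ht] at h1
    have : 0 ≤ m * (((n : ℝ) - 1) * lam) := by positivity
    linarith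
  have hmn : m = (n : ℝ) - 1 := by
    have h1 := (mul_eq_zero.mp (hG t ht)).resolve_left (hf'ne t ht)
    rw [h0 t ht] at h1
    simp only [mul_zero, sub_zero, mul_eq_zero, hm.ne', hn'.ne', hlam.ne] at h1
    norm_num at h1
    linarith
  refine ⟨hmn, hlam, h0, ?_⟩
  intro s hs
  rw [hF1 s hs, h0 s hs, hmn]
  ring
end

section
/- Let n ≥ 3 be an integer, set m = (n−1)/2, let λ, β ∈ ℝ and A > 0, let I ⊆ ℝ be a nonempty open interval, and let f : I → ℝ be three times continuously differentiable with f'(t) ≠ 0 for all t ∈ I. Suppose that for all t ∈ I: (F1) (f'(t))² = 2m·(f''(t) − (n−1)λ) and (F2) 0 = β − (A²/(n−1))·e^{−2f(t)/(n−1)}·(2(n−1)²λ + (f'(t))² − f''(t)). Then λ = 0, and there exist a ≠ 0 and c ∈ ℝ such that for all t ∈ I: e^{−f(t)/(n−1)} = a·(t−c) (with a·(t−c) > 0 on I). -/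
lemma const_of_hasDerivAt_zero {I : Set ℝ} (hI : IsOpen I) (hc : I.OrdConnected) (g : ℝ → ℝ)
    (hg : ∀ t ∈ I, HasDerivAt g 0 t) : ∀ s ∈ I, ∀ t ∈ I, g s = g t := by
  intro s hs t ht
  exact hI.is_const_of_deriv_eq_zero hc.isPreconnected
    (fun x hx => (hg x hx).differentiableAt.differentiableWithinAt)
    (fun x hx => (hg x hx).deriv) hs ht

/-- The case m = (n-1)/2 in the proof of Theorem 1.2 of the paper. -/
theorem stmt_5 (n : ℕ) (hn : 3 ≤ n) (m : ℝ) (hm : m = ((n : ℝ) - 1) / 2)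
    (lam β : ℝ) (A : ℝ) (hA : 0 < A)
    (I : Set ℝ) (hIopen : IsOpen I) (hIconn : I.OrdConnected) (hIne : I.Nonempty)
    (f f' f'' f''' : ℝ → ℝ)
    (hf : ∀ t ∈ I, HasDerivAt f (f' t) t)
    (hf' : ∀ t ∈ I, HasDerivAt f' (f'' t) t)
    (hf'' : ∀ t ∈ I, HasDerivAt f'' (f''' t) t)
    (hf'ne : ∀ t ∈ I, f' t ≠ 0)
    (hF1 : ∀ t ∈ I, (f' t) ^ 2 = 2 * m * (f'' t - ((n : ℝ) - 1) * lam))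
    (hF2 : ∀ t ∈ I, 0 = β - (A ^ 2 / ((n : ℝ) - 1)) *
      Real.exp (-2 * f t / ((n : ℝ) - 1)) *
      (2 * ((n : ℝ) - 1) ^ 2 * lam + (f' t) ^ 2 - f'' t)) :
    lam = 0 ∧ ∃ a c : ℝ, a ≠ 0 ∧ ∀ t ∈ I,
      Real.exp (-f t / ((n : ℝ) - 1)) = a * (t - c) ∧ 0 < a * (t - c) := by
  subst hm
  have hn' : (3 : ℝ) ≤ n := by exact_mod_cast hn
  obtain ⟨k, hk⟩ : ∃ k : ℝ, k = (n : ℝ) - 1 := ⟨_, rfl⟩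
  have hk2 : 2 ≤ k := by linarith
  simp only [← hk] at hF1 hF2 ⊢
  clear hk
  have hk0 : k ≠ 0 := by positivity
  have hp : ∀ t ∈ I, f'' t = f' t ^ 2 / k + k * lam := by
    intro t ht
    have := hF1 t ht
    field_simp
    linear_combination -this
  obtain ⟨t₀, ht₀⟩ := hIne
  have hlam : lam = 0 := by
    have hG : HasDerivAt (fun x => Real.exp (-2 * f x / k) *
        (2 * k ^ 2 * lam + f' x ^ 2 - (f' x ^ 2 / k + k * lam)))
        (Real.exp (-2 * f t₀ / k) * (-2 * f' t₀ / k) *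
          (2 * k ^ 2 * lam + f' t₀ ^ 2 - (f' t₀ ^ 2 / k + k * lam)) +
          Real.exp (-2 * f t₀ / k) *
          (2 * f' t₀ * f'' t₀ - 2 * f' t₀ * f'' t₀ / k)) t₀ := by
      have h1 := (((hf t₀ ht₀).const_mul (-2)).div_const k).exp
      have h2 := (hf' t₀ ht₀).pow 2
      have h3 := (h2.const_add (2 * k ^ 2 * lam)).sub ((h2.div_const k).add_const (k * lam))
      refine (h1.mul h3).congr_deriv ?_
      simp
    have hc : HasDerivAt (fun x => Real.exp (-2 * f x / k) *
        (2 * k ^ 2 * lam + f' x ^ 2 - (f' x ^ 2 / k + k * lam))) 0 t₀ := by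
      refine (hasDerivAt_const t₀ (β * k / A ^ 2)).congr_of_eventuallyEq ?_
      filter_upwards [hIopen.mem_nhds ht₀] with x hx
      have h := hF2 x hx
      rw [hp x hx] at h
      rw [eq_div_iff (by positivity)]
      generalize Real.exp (-2 * f x / k) = z at *
      generalize (2 * k ^ 2 * lam + f' x ^ 2 - (f' x ^ 2 / k + k * lam)) = y at *
      field_simp at h
      linear_combination h
    have h := hG.unique hc
    rw [hp t₀ ht₀] at h
    have h2 : Real.exp (-2 * f t₀ / k) * f' t₀ * k * lam = 0 := by
      field_simp at h ⊢
      first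
        | linear_combination h
        | (have := Real.exp_ne_zero (-2 * f t₀ / k); have := hf'ne t₀ ht₀; grind)
    have := Real.exp_ne_zero (-2 * f t₀ / k)
    have := hf'ne t₀ ht₀
    simpa [*] using h2
  refine ⟨hlam, ?_⟩
  have hphi : ∀ t ∈ I, HasDerivAt (fun x => Real.exp (-f x / k))
      (Real.exp (-f t / k) * (-f' t / k)) t := fun t ht =>
    ((hf t ht).neg.div_const k).exp
  have hphi2 : ∀ t ∈ I, HasDerivAt (fun x => Real.exp (-f x / k) * (-f' x / k)) 0 t := by
    intro t ht
    refine ((hphi t ht).mul ((hf' t ht).neg.div_const k)).congr_deriv ?_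
    rw [hp t ht, hlam]
    simp only [Pi.neg_apply]
    field_simp
    ring
  have hca := const_of_hasDerivAt_zero hIopen hIconn _ hphi2
  obtain ⟨a, ha⟩ : ∃ a, a = Real.exp (-f t₀ / k) * (-f' t₀ / k) := ⟨_, rfl⟩
  have ha0 : a ≠ 0 := by
    rw [ha]
    exact mul_ne_zero (Real.exp_ne_zero _) (div_ne_zero (neg_ne_zero.2 (hf'ne t₀ ht₀)) hk0)
  have hlin : ∀ t ∈ I, HasDerivAt (fun x => Real.exp (-f x / k) - a * x) 0 t := by
    intro t ht
    refine ((hphi t ht).sub ((hasDerivAt_id t).const_mul a)).congr_deriv ?_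
    have := hca t ht t₀ ht₀
    rw [this, ← ha]
    ring
  have hcb := const_of_hasDerivAt_zero hIopen hIconn _ hlin
  refine ⟨a, t₀ - Real.exp (-f t₀ / k) / a, ha0, fun t ht => ?_⟩
  have h := hcb t ht t₀ ht₀
  have e : Real.exp (-f t / k) = a * (t - (t₀ - Real.exp (-f t₀ / k) / a)) := by
    have : a * (Real.exp (-f t₀ / k) / a) = Real.exp (-f t₀ / k) := by field_simp
    linear_combination h - this
  exact ⟨e, e ▸ Real.exp_pos _⟩
end

section
/- Let n ≥ 3 be an integer, set m = 1/2, let λ, β ∈ ℝ and A > 0, let I ⊆ ℝ be a nonempty open interval, and let f : I → ℝ be three times continuously differentiable with f'(t) ≠ 0 for all t ∈ I. Suppose that for all t ∈ I: (F1) (f'(t))² = f''(t) − (n−1)λ and (F2) 0 = β − (A²/(n−1))·e^{−2f(t)/(n−1)}·(2(n−1)²λ + (f'(t))² − f''(t)). Then λ = 0, β = 0, and there exist a ≠ 0 and c ∈ ℝ such that for all t ∈ I: e^{−f(t)} = a·(t−c) (with a·(t−c) > 0 on I). -/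
/-- The case m = 1/2 in the proof of Theorem 1.2 of the paper, leading to the
exceptional non-Einstein family of Example 1.2. -/
theorem stmt_6 (n : ℕ) (hn : 3 ≤ n) (m : ℝ) (hm : m = 1 / 2)
    (lam β : ℝ) (A : ℝ) (hA : 0 < A)
    (I : Set ℝ) (hIopen : IsOpen I) (hIconn : I.OrdConnected) (hIne : I.Nonempty)
    (f f' f'' f''' : ℝ → ℝ)
    (hf : ∀ t ∈ I, HasDerivAt f (f' t) t)
    (hf' : ∀ t ∈ I, HasDerivAt f' (f'' t) t)
    (hf'' : ∀ t ∈ I, HasDerivAt f'' (f''' t) t)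
    (hf'ne : ∀ t ∈ I, f' t ≠ 0)
    (hF1 : ∀ t ∈ I, (f' t) ^ 2 = f'' t - ((n : ℝ) - 1) * lam)
    (hF2 : ∀ t ∈ I, 0 = β - (A ^ 2 / ((n : ℝ) - 1)) *
      Real.exp (-2 * f t / ((n : ℝ) - 1)) *
      (2 * ((n : ℝ) - 1) ^ 2 * lam + (f' t) ^ 2 - f'' t)) :
    lam = 0 ∧ β = 0 ∧ ∃ a c : ℝ, a ≠ 0 ∧ ∀ t ∈ I,
      Real.exp (-f t) = a * (t - c) ∧ 0 < a * (t - c) := by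
  obtain ⟨t0, ht0⟩ := hIne
  have hn' : (3 : ℝ) ≤ n := by exact_mod_cast hn
  obtain ⟨N, hN⟩ : ∃ N : ℝ, N = (n : ℝ) - 1 := ⟨_, rfl⟩
  rw [← hN] at hF1 hF2
  have hN2 : 2 ≤ N := by linarith
  have hN0 : N ≠ 0 := by positivity
  have key : ∀ t ∈ I, β = A ^ 2 * Real.exp (-2 * f t / N) * (lam * (2 * N - 1)) := by
    intro t ht
    have h1 := hF1 t ht
    have h2 := hF2 t ht
    have h3 : 2 * N ^ 2 * lam + f' t ^ 2 - f'' t = N * (lam * (2 * N - 1)) := by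
      rw [h1]; ring
    rw [h3] at h2
    have h4 : A ^ 2 / N * Real.exp (-2 * f t / N) * (N * (lam * (2 * N - 1)))
        = A ^ 2 * Real.exp (-2 * f t / N) * (lam * (2 * N - 1)) := by
      field_simp
    linarith
  have hlam : lam = 0 := by
    have d1 : HasDerivAt (fun t => A ^ 2 * Real.exp (-2 * f t / N) * (lam * (2 * N - 1)))
        (A ^ 2 * (Real.exp (-2 * f t0 / N) * (-2 * f' t0 / N)) * (lam * (2 * N - 1))) t0 :=
      (((((hf t0 ht0).const_mul (-2)).div_const N).exp).const_mul (A ^ 2)).mul_const _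
    have d2 : HasDerivAt (fun t => A ^ 2 * Real.exp (-2 * f t / N) * (lam * (2 * N - 1)))
        0 t0 := by
      refine (hasDerivAt_const t0 β).congr_of_eventuallyEq ?_
      filter_upwards [hIopen.mem_nhds ht0] with t ht
      exact (key t ht).symm
    have h := d1.unique d2
    have hK : 2 * N - 1 ≠ 0 := by
      have : 0 < 2 * N - 1 := by linarith
      exact this.ne'
    have := hf'ne t0 ht0
    simpa [hA.ne', hN0, hK, this, Real.exp_ne_zero] using h
  have hβ : β = 0 := by
    rw [key t0 ht0, hlam]; ring
  have hpre : IsPreconnected I := hIconn.isPreconnected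
  have dE : ∀ t ∈ I, HasDerivAt (fun t => Real.exp (-f t)) (Real.exp (-f t) * (-f' t)) t :=
    fun t ht => (hf t ht).neg.exp
  have dG : ∀ t ∈ I, HasDerivAt (fun t => Real.exp (-f t) * (-f' t)) 0 t := by
    intro t ht
    have h := (dE t ht).mul (hf' t ht).neg
    have h1 := hF1 t ht
    rw [hlam] at h1
    refine h.congr_deriv ?_
    have h2 : f'' t = f' t ^ 2 := by linarith
    simp only [Pi.neg_apply, h2]; ring
  obtain ⟨a, ha⟩ := hIopen.exists_is_const_of_deriv_eq_zero hpre
    (fun t ht => (dG t ht).differentiableAt.differentiableWithinAt)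
    (fun t ht => (dG t ht).deriv)
  have dH : ∀ t ∈ I, HasDerivAt (fun t => Real.exp (-f t) - a * t) 0 t := by
    intro t ht
    have h := (dE t ht).sub ((hasDerivAt_id t).const_mul a)
    refine h.congr_deriv ?_
    have := ha t ht
    rw [this]; ring
  obtain ⟨b, hb⟩ := hIopen.exists_is_const_of_deriv_eq_zero hpre
    (fun t ht => (dH t ht).differentiableAt.differentiableWithinAt)
    (fun t ht => (dH t ht).deriv)
  have ha0 : a ≠ 0 := by
    rw [← ha t0 ht0]
    exact mul_ne_zero (Real.exp_ne_zero _) (neg_ne_zero.mpr (hf'ne t0 ht0))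
  refine ⟨hlam, hβ, a, -b / a, ha0, fun t ht => ?_⟩
  have h1 : Real.exp (-f t) = a * (t - -b / a) := by
    have := hb t ht
    field_simp
    linarith
  exact ⟨h1, h1 ▸ Real.exp_pos _⟩
end

section
/- Let n ≥ 3 be an integer, let m = 1/2, λ = 0, β = 0, let A, B > 0, let μ ∈ ℝ, let I ⊆ (0,∞) be a nonempty open interval, and define φ, f : I → ℝ by φ(t) = A·(Bt)^{1/(n−1)} and f(t) = −log(Bt). Then equations (E1) and (E2) of the weighted Einstein ODE system hold on I, and equation (E3) holds on I if and only if μ = 0. -/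
/-- The weighted Schouten scalar `J` of the warped-product SMMS, defined by
`2(n+m-1) J = (n-1)(β-(n-2)(φ')²)/φ² + 2(n-1)(φ'f'-φ'')/φ + 2f'' - ((m+1)/m)(f')² + m(m-1)μ e^{2f/m}`. -/
noncomputable def weightedJ (n : ℕ) (m μ β : ℝ) (φ f : ℝ → ℝ) (t : ℝ) : ℝ :=
  (1 / (2 * ((n : ℝ) + m - 1))) *
    (((n : ℝ) - 1) * (β - ((n : ℝ) - 2) * (deriv φ t) ^ 2) / (φ t) ^ 2
      + 2 * ((n : ℝ) - 1) * (deriv φ t * deriv f t - deriv (deriv φ) t) / φ t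
      + 2 * deriv (deriv f) t - ((m + 1) / m) * (deriv f t) ^ 2
      + m * (m - 1) * μ * Real.exp (2 * f t / m))

/-- Equation (E1): `β - φ''φ - (n-2)(φ')² - 2(n-1)λφ² = 0`. -/
def wE1 (n : ℕ) (lam β : ℝ) (φ : ℝ → ℝ) (t : ℝ) : Prop :=
  β - deriv (deriv φ) t * φ t - ((n : ℝ) - 2) * (deriv φ t) ^ 2
    - 2 * ((n : ℝ) - 1) * lam * (φ t) ^ 2 = 0

/-- Equation (E2): `f'' - (n-1)φ''/φ - (1/m)(f')² - φ'f'/φ - 2(n-1)λ = 0`. -/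
def wE2 (n : ℕ) (m lam : ℝ) (φ f : ℝ → ℝ) (t : ℝ) : Prop :=
  deriv (deriv f) t - ((n : ℝ) - 1) * deriv (deriv φ) t / φ t
    - (1 / m) * (deriv f t) ^ 2 - deriv φ t * deriv f t / φ t
    - 2 * ((n : ℝ) - 1) * lam = 0

/-- Equation (E3): `φ'f'/φ + (n-m)λ - J = 0`. -/
def wE3 (n : ℕ) (m lam μ β : ℝ) (φ f : ℝ → ℝ) (t : ℝ) : Prop :=
  deriv φ t * deriv f t / φ t + ((n : ℝ) - m) * lam - weightedJ n m μ β φ f t = 0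

/-- The weighted Einstein ODE system of Lemma 3.5 of the paper, characterizing
warped-product SMMSs `I ×_φ N` with Einstein fiber that are weighted Einstein
with weighted harmonic Weyl tensor. -/
def WeightedEinsteinODE (n : ℕ) (m lam μ β : ℝ) (I : Set ℝ) (φ f : ℝ → ℝ) : Prop :=
  ∀ t ∈ I, wE1 n lam β φ t ∧ wE2 n m lam φ f t ∧ wE3 n m lam μ β φ f t

/-- Example 1.2 of the paper satisfies (E1) and (E2), and satisfies (E3) iff μ = 0. -/
theorem stmt_7 (n : ℕ) (hn : 3 ≤ n) (A B : ℝ) (hA : 0 < A) (hB : 0 < B) (μ : ℝ)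
    (I : Set ℝ) (hIopen : IsOpen I) (hIconn : I.OrdConnected)
    (hIsub : I ⊆ Set.Ioi (0 : ℝ)) (hIne : I.Nonempty)
    (φ f : ℝ → ℝ)
    (hφ : ∀ t, φ t = A * (B * t) ^ (1 / ((n : ℝ) - 1)))
    (hf : ∀ t, f t = -Real.log (B * t)) :
    (∀ t ∈ I, wE1 n 0 0 φ t ∧ wE2 n (1 / 2) 0 φ f t) ∧
      ((∀ t ∈ I, wE3 n (1 / 2) 0 μ 0 φ f t) ↔ μ = 0) := by
  have hN : (0:ℝ) < (n:ℝ) - 1 := by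
    have : (3:ℝ) ≤ n := by exact_mod_cast hn
    linarith
  have hN2 : (0:ℝ) < 2 * ((n:ℝ) - 1) + 1 := by linarith
  have hfpos : ∀ t, 0 < t → 0 < φ t := by
    intro t ht
    rw [hφ]
    positivity
  have hφ1 : ∀ t, 0 < t → HasDerivAt φ (1 / ((n : ℝ) - 1) * φ t / t) t := by
    intro t ht
    have hBt : 0 < B * t := by positivity
    have h0 : HasDerivAt (fun s : ℝ => B * s) B t := by
      simpa using (hasDerivAt_id t).const_mul B
    have h1 := (h0.rpow_const (p := 1 / ((n : ℝ) - 1)) (Or.inl hBt.ne')).const_mul A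
    have he : φ = fun s => A * (B * s) ^ (1 / ((n : ℝ) - 1)) := funext hφ
    rw [hφ t, he]
    refine h1.congr_deriv ?_
    rw [Real.rpow_sub_one hBt.ne']
    field_simp
  have hf1 : ∀ t, 0 < t → HasDerivAt f (-t⁻¹) t := by
    intro t ht
    have hBt : 0 < B * t := by positivity
    have h0 : HasDerivAt (fun s : ℝ => B * s) B t := by
      simpa using (hasDerivAt_id t).const_mul B
    have he : f = fun s => -Real.log (B * s) := funext hf
    rw [he]
    refine (h0.log hBt.ne').neg.congr_deriv ?_
    field_simp
  have hφ2 : ∀ t, 0 < t → deriv (deriv φ) t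
      = 1 / ((n : ℝ) - 1) * (1 / ((n : ℝ) - 1) - 1) * φ t / t ^ 2 := by
    intro t ht
    have he : deriv φ =ᶠ[nhds t] fun s => 1 / ((n : ℝ) - 1) * φ s / s := by
      filter_upwards [lt_mem_nhds ht] with s hs
      exact (hφ1 s hs).deriv
    rw [he.deriv_eq, (((hφ1 t ht).const_mul (1 / ((n : ℝ) - 1))).fun_div (hasDerivAt_id' t) ht.ne').deriv]
    field_simp
  have hf2 : ∀ t, 0 < t → deriv (deriv f) t = 1 / t ^ 2 := by
    intro t ht
    have he : deriv f =ᶠ[nhds t] fun s => -s⁻¹ := by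
      filter_upwards [lt_mem_nhds ht] with s hs
      exact (hf1 s hs).deriv
    rw [he.deriv_eq, ((hasDerivAt_inv ht.ne').fun_neg).deriv]
    field_simp
  have key : ∀ t, 0 < t → (wE3 n (1 / 2) 0 μ 0 φ f t ↔ μ = 0) := by
    intro t ht
    have hp := hfpos t ht
    have hE := Real.exp_pos (2 * f t / (1 / 2))
    unfold wE3 weightedJ
    rw [hφ2 t ht, hf2 t ht, (hφ1 t ht).deriv, (hf1 t ht).deriv]
    generalize Real.exp (2 * f t / (1 / 2)) = E at hE ⊢
    generalize φ t = y at hp ⊢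
    have hn' : (n:ℝ) = ((n:ℝ) - 1) + 1 := by ring
    generalize (n:ℝ) - 1 = N at hN hN2 hn' ⊢
    rw [hn']
    have : 1 / N * y / t * -t⁻¹ / y + (N + 1 - 1 / 2) * 0 -
      1 / (2 * (N + 1 + 1 / 2 - 1)) *
        (N * (0 - (N + 1 - 2) * (1 / N * y / t) ^ 2) / y ^ 2 +
          2 * N * (1 / N * y / t * -t⁻¹ - 1 / N * (1 / N - 1) * y / t ^ 2) / y +
          2 * (1 / t ^ 2) - (1 / 2 + 1) / (1 / 2) * (-t⁻¹) ^ 2 +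
          1 / 2 * (1 / 2 - 1) * μ * E) = μ * (E / (4 * (2 * N + 1))) := by
      have e : 2 * (N + 1 + 1 / 2 - 1) = 2 * N + 1 := by ring
      rw [e]
      field_simp
      ring
    have h4 : E / (4 * (2 * N + 1)) ≠ 0 := by positivity
    constructor
    · intro h
      have h5 : μ * (E / (4 * (2 * N + 1))) = 0 := by
        rw [← this]
        simpa using h
      exact (mul_eq_zero.mp h5).resolve_right h4
    · intro h
      have h5 : μ * (E / (4 * (2 * N + 1))) = 0 := by simp [h]
      rw [← this] at h5
      simpa using h5
  refine ⟨fun t hI => ?_, ?_, fun h t hI => (key t (hIsub hI)).2 h⟩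
  · have ht : 0 < t := hIsub hI
    have hp := hfpos t ht
    unfold wE1 wE2
    rw [hφ2 t ht, hf2 t ht, (hφ1 t ht).deriv, (hf1 t ht).deriv]
    constructor
    · field_simp
      ring
    · field_simp
      ring
  · intro h
    obtain ⟨t, hI⟩ := hIne
    exact (key t (hIsub hI)).1 (h t hI)
end

section
/- Let n ≥ 3 be an integer, let m > 0 with m ≠ 1, let λ = 0 and β, μ ∈ ℝ, let I ⊆ ℝ be an open interval with 0 ∈ I, and let φ, f : I → ℝ be smooth with φ(t) > 0 for all t ∈ I and f non-constant. Suppose (φ, f) satisfies the weighted Einstein ODE system for (n, m, 0, μ, β) on I and in addition φ''(t) = 0 for all t ∈ I. Then there exist constants c₁ ∈ ℝ, c₂ > 0, c₃ > 0, c₄ ≠ 0 such that for all t ∈ I: φ(t) = c₁·t + c₂ and f(t) = −m·log( c₃ − c₄·(c₁t² + 2c₂t) ), and moreover β = c₁²(n−2) and μ = 4c₄(c₁c₃ + c₂²c₄). -/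
theorem aux_const {I : Set ℝ} (hIopen : IsOpen I) (hIconn : I.OrdConnected) (hI0 : (0 : ℝ) ∈ I)
    (g : ℝ → ℝ) (hg : ∀ t ∈ I, HasDerivAt g 0 t) : ∀ t ∈ I, g t = g 0 := by
  intro t ht
  exact hIopen.is_const_of_deriv_eq_zero hIconn.isPreconnected
    (fun x hx => (hg x hx).differentiableAt.differentiableWithinAt)
    (fun x hx => (hg x hx).deriv) ht hI0

theorem aux_diff {I : Set ℝ} (hIopen : IsOpen I) (g : ℝ → ℝ)
    (hg : ContDiffOn ℝ (⊤ : ℕ∞) g I) : ∀ t ∈ I,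
    HasDerivAt g (deriv g t) t ∧ HasDerivAt (deriv g) (deriv (deriv g) t) t := by
  intro t ht
  have h1 : ContDiffOn ℝ 1 (deriv g) I :=
    hg.deriv_of_isOpen hIopen (by
      change ((2 : ℕ∞) : WithTop ℕ∞) ≤ ((⊤ : ℕ∞) : WithTop ℕ∞)
      exact WithTop.coe_le_coe.mpr le_top)
  exact ⟨((hg.differentiableOn (by simp)).differentiableAt (hIopen.mem_nhds ht)).hasDerivAt,
    ((h1.differentiableOn (by simp)).differentiableAt (hIopen.mem_nhds ht)).hasDerivAt⟩

/-- Case (2) (λ = 0) of Theorem 4.1 of the paper. -/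
theorem stmt_9 (n : ℕ) (hn : 3 ≤ n) (m : ℝ) (hm : 0 < m) (hm1 : m ≠ 1)
    (β μ : ℝ)
    (I : Set ℝ) (hIopen : IsOpen I) (hIconn : I.OrdConnected) (hI0 : (0 : ℝ) ∈ I)
    (φ f : ℝ → ℝ) (hφ : ContDiffOn ℝ (⊤ : ℕ∞) φ I) (hf : ContDiffOn ℝ (⊤ : ℕ∞) f I)
    (hφpos : ∀ t ∈ I, 0 < φ t)
    (hfnc : ¬ ∃ c : ℝ, ∀ t ∈ I, f t = c)
    (hsys : WeightedEinsteinODE n m 0 μ β I φ f)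
    (hEin : ∀ t ∈ I, deriv (deriv φ) t = 0) :
    ∃ c₁ c₂ c₃ c₄ : ℝ, 0 < c₂ ∧ 0 < c₃ ∧ c₄ ≠ 0 ∧
      (∀ t ∈ I,
        φ t = c₁ * t + c₂ ∧
        f t = -m * Real.log (c₃ - c₄ * (c₁ * t ^ 2 + 2 * c₂ * t))) ∧
      β = c₁ ^ 2 * ((n : ℝ) - 2) ∧
      μ = 4 * c₄ * (c₁ * c₃ + c₂ ^ 2 * c₄) := by
  have hφd := aux_diff hIopen φ hφ
  have hfd := aux_diff hIopen f hf
  have hm0 : m ≠ 0 := hm.ne'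
  have hφ' : ∀ t ∈ I, deriv φ t = deriv φ 0 := by
    apply aux_const hIopen hIconn hI0
    intro t ht
    have := (hφd t ht).2
    rwa [hEin t ht] at this
  have hφf : ∀ t ∈ I, φ t = deriv φ 0 * t + φ 0 := by
    intro t ht
    have := aux_const hIopen hIconn hI0 (fun t => φ t - deriv φ 0 * t) (by
      intro t ht
      have h := (hφd t ht).1.sub ((hasDerivAt_id t).const_mul (deriv φ 0))
      refine h.congr_deriv ?_
      rw [hφ' t ht]
      ring) t ht
    linarith
  have hv : ∀ t ∈ I, HasDerivAt (fun s => Real.exp (-f s / m))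
      (Real.exp (-f t / m) * (-deriv f t / m)) t :=
    fun t ht => (((hfd t ht).1.neg).div_const m).exp
  obtain ⟨k, hk⟩ : ∃ k : ℝ, ∀ t ∈ I, Real.exp (-f t / m) * (-deriv f t / m) = k * φ t := by
    refine ⟨Real.exp (-f 0 / m) * (-deriv f 0 / m) / φ 0, fun t ht => ?_⟩
    have := aux_const hIopen hIconn hI0
      (fun t => Real.exp (-f t / m) * (-deriv f t / m) / φ t) (by
      intro t ht
      have hp := (hφpos t ht).ne'
      have h := ((hv t ht).mul (((hfd t ht).2.neg).div_const m)).div (hφd t ht).1 hp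
      refine h.congr_deriv ?_
      have h2 := (hsys t ht).2.1
      unfold wE2 at h2
      rw [hEin t ht] at h2
      have h3 : deriv (deriv f) t = (1 / m) * (deriv f t) ^ 2 + deriv φ t * deriv f t / φ t := by
        linear_combination h2
      simp only [Pi.neg_apply, Pi.mul_apply]
      rw [h3]
      field_simp
      ring) t ht
    rw [← this]
    field_simp [(hφpos t ht).ne']
  have hvf : ∀ t ∈ I, Real.exp (-f t / m)
      = Real.exp (-f 0 / m) + k * (deriv φ 0 * t ^ 2 / 2 + φ 0 * t) := by
    intro t ht
    have := aux_const hIopen hIconn hI0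
      (fun t => Real.exp (-f t / m) - k * (deriv φ 0 * t ^ 2 / 2 + φ 0 * t)) (by
      intro t ht
      have h := (hv t ht).sub (((((hasDerivAt_pow 2 t).const_mul (deriv φ 0)).div_const 2).add
        ((hasDerivAt_id t).const_mul (φ 0))).const_mul k)
      refine h.congr_deriv ?_
      rw [hk t ht, hφf t ht]
      push_cast
      ring) t ht
    linarith
  have hff : ∀ t ∈ I, f t = -m * Real.log (Real.exp (-f 0 / m)
      + k * (deriv φ 0 * t ^ 2 / 2 + φ 0 * t)) := by
    intro t ht
    rw [← hvf t ht, Real.log_exp]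
    field_simp
  have hβ : β = (deriv φ 0) ^ 2 * ((n : ℝ) - 2) := by
    have h1 := (hsys 0 hI0).1
    unfold wE1 at h1
    rw [hEin 0 hI0] at h1
    linear_combination h1
  refine ⟨deriv φ 0, φ 0, Real.exp (-f 0 / m), -k / 2, hφpos 0 hI0, Real.exp_pos _, ?_, ?_, hβ, ?_⟩
  · intro h
    have hk0 : k = 0 := by linarith
    apply hfnc
    refine ⟨-m * Real.log (Real.exp (-f 0 / m)), fun t ht => ?_⟩
    rw [hff t ht, hk0, zero_mul, add_zero]
  · intro t ht
    refine ⟨hφf t ht, ?_⟩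
    rw [hff t ht]
    congr 2
    ring
  · have h2 := (hsys 0 hI0).2.1
    have h3 := (hsys 0 hI0).2.2
    have hk0 := hk 0 hI0
    have hp := (hφpos 0 hI0).ne'
    unfold wE2 at h2
    unfold wE3 weightedJ at h3
    rw [hEin 0 hI0] at h2 h3
    have h4 : deriv (deriv f) 0 = (1 / m) * (deriv f 0) ^ 2 + deriv φ 0 * deriv f 0 / φ 0 := by
      linear_combination h2
    have hE : Real.exp (2 * f 0 / m) = 1 / Real.exp (-f 0 / m) ^ 2 := by
      rw [← Real.exp_nat_mul, one_div, ← Real.exp_neg]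
      congr 1
      push_cast
      ring
    have hvne : Real.exp (-f 0 / m) ≠ 0 := (Real.exp_pos _).ne'
    rw [h4, hE, hβ] at h3
    generalize Real.exp (-f 0 / m) = v at *
    have hf' : deriv f 0 = -m * k * φ 0 / v := by
      field_simp
      field_simp at hk0
      linear_combination -hk0
    rw [hf'] at h3
    have hn' : (3 : ℝ) ≤ n := by exact_mod_cast hn
    have hnm : (n : ℝ) + m - 1 ≠ 0 := by
      have : 0 < (n : ℝ) + m - 1 := by linarith
      exact this.ne'
    have hm1' : m - 1 ≠ 0 := sub_ne_zero.mpr hm1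
    field_simp at h3
    apply mul_left_cancel₀ (mul_ne_zero (mul_ne_zero hm0 hm1') (pow_ne_zero 2 hp))
    ring_nf at h3 ⊢
    linear_combination -h3
end

section
/- Let n ≥ 3 be an integer, let m > 0 with m ≠ 1, let λ < 0 and β, μ ∈ ℝ, let I ⊆ ℝ be an open interval with 0 ∈ I, and let φ, f : I → ℝ be smooth with φ(t) > 0 for all t ∈ I and f non-constant. Suppose (φ, f) satisfies the weighted Einstein ODE system for (n, m, λ, μ, β) on I and in addition φ''(t) = −2λ·φ(t) for all t ∈ I. Then there exist constants c₁, c₂ ∈ ℝ with c₁ + c₂ > 0, c₃ > 0, c₄ ≠ 0 such that for all t ∈ I: φ(t) = c₁·e^{√(−2λ)·t} + c₂·e^{−√(−2λ)·t} and f(t) = −m·log( c₃ + c₂c₄·(e^{−√(−2λ)·t} − 1) − c₁c₄·(e^{√(−2λ)·t} − 1) ), and moreover β = 8c₁c₂(n−2)λ and μ = −2·( 2(c₁−c₂)c₃c₄ + (c₁+c₂)²c₄² + c₃² )·λ. -/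
theorem const_aux (I : Set ℝ) (hIconn : I.OrdConnected) (hI0 : (0 : ℝ) ∈ I)
    (g : ℝ → ℝ) (hg : ∀ t ∈ I, HasDerivAt g 0 t) : ∀ t ∈ I, g t = g 0 := by
  intro t ht
  have h := hIconn.convex.norm_image_sub_le_of_norm_hasDerivWithin_le (f := g) (f' := fun _ => 0)
    (C := 0) (fun x hx => (hg x hx).hasDerivWithinAt) (by simp) hI0 ht
  simp only [zero_mul, norm_le_zero_iff] at h
  linarith

/-- Case (3) (λ < 0) of Theorem 4.1 of the paper. -/
theorem stmt_10 (n : ℕ) (hn : 3 ≤ n) (m : ℝ) (hm : 0 < m) (hm1 : m ≠ 1)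
    (lam : ℝ) (hlam : lam < 0) (β μ : ℝ)
    (I : Set ℝ) (hIopen : IsOpen I) (hIconn : I.OrdConnected) (hI0 : (0 : ℝ) ∈ I)
    (φ f : ℝ → ℝ) (hφ : ContDiffOn ℝ (⊤ : ℕ∞) φ I) (hf : ContDiffOn ℝ (⊤ : ℕ∞) f I)
    (hφpos : ∀ t ∈ I, 0 < φ t)
    (hfnc : ¬ ∃ c : ℝ, ∀ t ∈ I, f t = c)
    (hsys : WeightedEinsteinODE n m lam μ β I φ f)
    (hEin : ∀ t ∈ I, deriv (deriv φ) t = -2 * lam * φ t) :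
    ∃ c₁ c₂ c₃ c₄ : ℝ, 0 < c₁ + c₂ ∧ 0 < c₃ ∧ c₄ ≠ 0 ∧
      (∀ t ∈ I,
        φ t = c₁ * Real.exp (Real.sqrt (-2 * lam) * t)
            + c₂ * Real.exp (-(Real.sqrt (-2 * lam) * t)) ∧
        f t = -m * Real.log (c₃ + c₂ * c₄ * (Real.exp (-(Real.sqrt (-2 * lam) * t)) - 1)
            - c₁ * c₄ * (Real.exp (Real.sqrt (-2 * lam) * t) - 1))) ∧
      β = 8 * c₁ * c₂ * ((n : ℝ) - 2) * lam ∧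
      μ = -2 * (2 * (c₁ - c₂) * c₃ * c₄ + (c₁ + c₂) ^ 2 * c₄ ^ 2 + c₃ ^ 2) * lam := by
  obtain ⟨s, hs⟩ : ∃ s, s = Real.sqrt (-2 * lam) := ⟨_, rfl⟩
  have hspos : 0 < s := by rw [hs]; apply Real.sqrt_pos.mpr; linarith
  have hs2 : s ^ 2 = -2 * lam := by rw [hs]; apply Real.sq_sqrt; linarith
  rw [← hs]
  have dd : ∀ g : ℝ → ℝ, ContDiffOn ℝ (⊤ : ℕ∞) g I → ∀ t ∈ I,
      HasDerivAt g (deriv g t) t ∧ HasDerivAt (deriv g) (deriv (deriv g) t) t := by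
    intro g hg t ht
    have h1 : ContDiffOn ℝ (⊤ : ℕ∞) (deriv g) I := hg.deriv_of_isOpen hIopen (by simp)
    exact ⟨((hg.differentiableOn (by simp)).differentiableAt (hIopen.mem_nhds ht)).hasDerivAt,
      ((h1.differentiableOn (by simp)).differentiableAt (hIopen.mem_nhds ht)).hasDerivAt⟩
  have dφ := dd φ hφ
  have df := dd f hf
  have hsm : ∀ t, HasDerivAt (fun t : ℝ => s * t) s t := fun t => by
    simpa using (hasDerivAt_id t).const_mul s
  have hep : ∀ t, HasDerivAt (fun t : ℝ => Real.exp (s * t)) (Real.exp (s * t) * s) t :=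
    fun t => (hsm t).exp
  have hem : ∀ t, HasDerivAt (fun t : ℝ => Real.exp (-(s * t))) (Real.exp (-(s * t)) * -s) t :=
    fun t => (hsm t).neg.exp
  have hev : ∀ t ∈ I, HasDerivAt (fun t : ℝ => Real.exp (-(f t / m)))
      (Real.exp (-(f t / m)) * -(deriv f t / m)) t :=
    fun t ht => (((df t ht).1.div_const m).neg).exp
  have hmul : ∀ t, Real.exp (s * t) * Real.exp (-(s * t)) = 1 := fun t => by
    rw [← Real.exp_add]; simp
  have hf2 : ∀ t ∈ I, deriv (deriv f) t = (deriv f t) ^ 2 / m + deriv φ t * deriv f t / φ t := by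
    intro t ht
    have h := (hsys t ht).2.1
    have hp := (hφpos t ht).ne'
    unfold wE2 at h
    rw [hEin t ht] at h
    have : ((n : ℝ) - 1) * (-2 * lam * φ t) / φ t = -2 * ((n : ℝ) - 1) * lam := by
      field_simp
    rw [this] at h
    have h3 : (1 / m) * (deriv f t) ^ 2 = (deriv f t) ^ 2 / m := by ring
    rw [h3] at h
    linarith
  have hA := const_aux I hIconn hI0 (fun t => (deriv φ t + s * φ t) * Real.exp (-(s * t))) (by
    intro t ht
    refine (((dφ t ht).2.add ((dφ t ht).1.const_mul s)).mul (hem t)).congr_deriv ?_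
    rw [hEin t ht, ← hs2]; simp only [Pi.add_apply]; ring)
  have hB := const_aux I hIconn hI0 (fun t => (deriv φ t - s * φ t) * Real.exp (s * t)) (by
    intro t ht
    refine (((dφ t ht).2.sub ((dφ t ht).1.const_mul s)).mul (hep t)).congr_deriv ?_
    rw [hEin t ht, ← hs2]; simp only [Pi.sub_apply]; ring)
  have hK := const_aux I hIconn hI0 (fun t => Real.exp (-(f t / m)) * deriv f t / φ t) (by
    intro t ht
    have hp := (hφpos t ht).ne'
    refine (((hev t ht).mul (df t ht).2).div (dφ t ht).1 hp).congr_deriv ?_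
    rw [hf2 t ht]; simp only [Pi.mul_apply]; field_simp; ring)
  simp only [mul_zero, neg_zero, Real.exp_zero, mul_one] at hA hB hK
  obtain ⟨K, hKdef⟩ : ∃ K, K = Real.exp (-(f 0 / m)) * deriv f 0 / φ 0 := ⟨_, rfl⟩
  rw [← hKdef] at hK
  obtain ⟨c₁, hc₁⟩ : ∃ c, c = (deriv φ 0 + s * φ 0) / (2 * s) := ⟨_, rfl⟩
  obtain ⟨c₂, hc₂⟩ : ∃ c, c = -(deriv φ 0 - s * φ 0) / (2 * s) := ⟨_, rfl⟩
  obtain ⟨c₃, hc₃⟩ : ∃ c, c = Real.exp (-(f 0 / m)) := ⟨_, rfl⟩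
  obtain ⟨c₄, hc₄⟩ : ∃ c, c = K / (m * s) := ⟨_, rfl⟩
  have hc₃pos : 0 < c₃ := by rw [hc₃]; exact Real.exp_pos _
  have hA0 : deriv φ 0 + s * φ 0 = 2 * s * c₁ := by rw [hc₁]; field_simp
  have hB0 : deriv φ 0 - s * φ 0 = -(2 * s * c₂) := by rw [hc₂]; field_simp
  have hK0 : K = m * s * c₄ := by rw [hc₄]; field_simp
  have hφ0 : φ 0 = c₁ + c₂ := by
    apply mul_left_cancel₀ (mul_ne_zero two_ne_zero hspos.ne'); linarith
  have hdφ0 : deriv φ 0 = s * (c₁ - c₂) := by linarith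
  have hφt : ∀ t ∈ I, φ t = c₁ * Real.exp (s * t) + c₂ * Real.exp (-(s * t)) := by
    intro t ht
    have a := hA t ht
    have b := hB t ht
    rw [hA0] at a
    rw [hB0] at b
    apply mul_left_cancel₀ (mul_ne_zero two_ne_zero hspos.ne')
    linear_combination Real.exp (s * t) * a - Real.exp (-(s * t)) * b
      - (2 * s * φ t) * hmul t
  have hdf : ∀ t ∈ I, Real.exp (-(f t / m)) * deriv f t = K * φ t := by
    intro t ht
    have hp := (hφpos t ht).ne'
    have := hK t ht
    rwa [div_eq_iff hp] at this
  have hV := const_aux I hIconn hI0 (fun t => Real.exp (-(f t / m))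
      + c₄ * (c₁ * Real.exp (s * t) - c₂ * Real.exp (-(s * t)))) (by
    intro t ht
    refine ((hev t ht).add ((((hep t).const_mul c₁).sub
      ((hem t).const_mul c₂)).const_mul c₄)).congr_deriv ?_
    have h1 := hdf t ht
    rw [hφt t ht, hK0] at h1
    have h2 : Real.exp (-(f t / m)) * -(deriv f t / m)
      = -(Real.exp (-(f t / m)) * deriv f t) / m := by ring
    rw [h2, h1]; field_simp; ring)
  simp only [mul_zero, neg_zero, Real.exp_zero, mul_one] at hV
  rw [← hc₃] at hV
  have hft : ∀ t ∈ I, f t = -m * Real.log (c₃ + c₂ * c₄ * (Real.exp (-(s * t)) - 1)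
            - c₁ * c₄ * (Real.exp (s * t) - 1)) := by
    intro t ht
    have : c₃ + c₂ * c₄ * (Real.exp (-(s * t)) - 1) - c₁ * c₄ * (Real.exp (s * t) - 1)
      = Real.exp (-(f t / m)) := by linear_combination -hV t ht
    rw [this, Real.log_exp]; field_simp
  refine ⟨c₁, c₂, c₃, c₄, ?_, hc₃pos, ?_, fun t ht => ⟨hφt t ht, hft t ht⟩, ?_, ?_⟩
  · rw [← hφ0]; exact hφpos 0 hI0
  · intro h0
    apply hfnc
    refine ⟨-m * Real.log c₃, fun t ht => ?_⟩
    rw [hft t ht, h0]; simp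
  · have h := (hsys 0 hI0).1
    unfold wE1 at h
    rw [hEin 0 hI0, hdφ0, hφ0] at h
    linear_combination h + ((n : ℝ) - 2) * (c₁ - c₂) ^ 2 * hs2
  · have h1 := (hsys 0 hI0).1
    have h := (hsys 0 hI0).2.2
    have hp := (hφpos 0 hI0).ne'
    have hn' : (3 : ℝ) ≤ n := by exact_mod_cast hn
    have hnm : (n : ℝ) + m - 1 ≠ 0 := by linarith
    have hm1' : m - 1 ≠ 0 := sub_ne_zero.mpr hm1
    have hv2 : Real.exp (2 * f 0 / m) = 1 / c₃ ^ 2 := by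
      rw [hc₃, ← Real.exp_nat_mul, one_div, ← Real.exp_neg]; congr 1; push_cast; ring
    have hdf0 : deriv f 0 = m * s * c₄ * φ 0 / c₃ := by
      have := hdf 0 hI0
      rw [← hc₃, hK0] at this
      rw [eq_div_iff hc₃pos.ne']; linarith
    unfold wE1 at h1
    unfold wE3 weightedJ at h
    have hb : β - ((n : ℝ) - 2) * (deriv φ 0) ^ 2 = 2 * ((n : ℝ) - 2) * lam * φ 0 ^ 2 := by
      rw [hEin 0 hI0] at h1; linear_combination h1
    rw [hb, hf2 0 hI0, hEin 0 hI0, hv2, hdf0, hdφ0] at h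
    rw [← hφ0]
    have hc3 := hc₃pos.ne'
    have hl : lam = -(s ^ 2) / 2 := by linarith
    rw [hl] at h ⊢
    field_simp at h
    have key : (m - 1) * μ = (m - 1) * (-2 * (2 * (c₁ - c₂) * c₃ * c₄ + φ 0 ^ 2 * c₄ ^ 2 + c₃ ^ 2)
        * (-(s ^ 2) / 2)) := by
      apply mul_left_cancel₀ hm.ne'
      linear_combination -h
    exact mul_left_cancel₀ hm1' key
end

section
/- Let n ≥ 3 be an integer, let m > 0 with m ≠ 1, let λ > 0, let c₁, c₃ > 0, c₂ ∈ ℝ, c₄ ≠ 0, and set β = 2(c₁² + c₂²)(n−2)λ and μ = 2(c₁²c₄² + 2c₂c₃c₄ − c₃²)λ. Let I ⊆ ℝ be a nonempty open interval such that for all t ∈ I both φ(t) := c₁·cos(√(2λ)·t) + c₂·sin(√(2λ)·t) > 0 and v(t) := c₃ + c₂c₄·(cos(√(2λ)·t) − 1) − c₁c₄·sin(√(2λ)·t) > 0, and define f : I → ℝ by f(t) = −m·log(v(t)). Then (φ, f) satisfies the weighted Einstein ODE system for (n, m, λ, μ, β) on I. -/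
/-- Existence (sufficiency) direction of case (1) of Theorem 4.1: the stated
functions solve the weighted Einstein ODE system for every λ > 0. -/
theorem stmt_11 (n : ℕ) (hn : 3 ≤ n) (m : ℝ) (hm : 0 < m) (hm1 : m ≠ 1)
    (lam : ℝ) (hlam : 0 < lam)
    (c₁ c₂ c₃ c₄ : ℝ) (hc₁ : 0 < c₁) (hc₃ : 0 < c₃) (hc₄ : c₄ ≠ 0)
    (β μ : ℝ)
    (hβ : β = 2 * (c₁ ^ 2 + c₂ ^ 2) * ((n : ℝ) - 2) * lam)
    (hμ : μ = 2 * (c₁ ^ 2 * c₄ ^ 2 + 2 * c₂ * c₃ * c₄ - c₃ ^ 2) * lam)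
    (I : Set ℝ) (hIopen : IsOpen I) (hIconn : I.OrdConnected) (hIne : I.Nonempty)
    (φ v f : ℝ → ℝ)
    (hφ : ∀ t, φ t = c₁ * Real.cos (Real.sqrt (2 * lam) * t)
        + c₂ * Real.sin (Real.sqrt (2 * lam) * t))
    (hv : ∀ t, v t = c₃ + c₂ * c₄ * (Real.cos (Real.sqrt (2 * lam) * t) - 1)
        - c₁ * c₄ * Real.sin (Real.sqrt (2 * lam) * t))
    (hφpos : ∀ t ∈ I, 0 < φ t) (hvpos : ∀ t ∈ I, 0 < v t)
    (hf : ∀ t, f t = -m * Real.log (v t)) :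
    WeightedEinsteinODE n m lam μ β I φ f := by
  intro t ht
  set w := Real.sqrt (2 * lam) with hw
  have hw2 : w ^ 2 = 2 * lam := Real.sq_sqrt (by positivity)
  have hlin : ∀ x, HasDerivAt (fun y : ℝ => w * y) w x := fun x => by
    simpa using (hasDerivAt_id x).const_mul w
  have hcos : ∀ x, HasDerivAt (fun y : ℝ => Real.cos (w * y)) (-Real.sin (w * x) * w) x :=
    fun x => (hlin x).cos
  have hsin : ∀ x, HasDerivAt (fun y : ℝ => Real.sin (w * y)) (Real.cos (w * x) * w) x :=
    fun x => (hlin x).sin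
  obtain ⟨ψ, hψ⟩ : ∃ ψ : ℝ → ℝ, ∀ x, ψ x = c₂ * Real.cos (w * x) - c₁ * Real.sin (w * x) :=
    ⟨_, fun _ => rfl⟩
  have dφ : ∀ x, HasDerivAt φ (w * ψ x) x := fun x => by
    rw [funext hφ, hψ]
    exact (((hcos x).const_mul c₁).add ((hsin x).const_mul c₂)).congr_deriv (by ring)
  have dψ : ∀ x, HasDerivAt ψ (-w * φ x) x := fun x => by
    rw [funext hψ, hφ]
    exact (((hcos x).const_mul c₂).sub ((hsin x).const_mul c₁)).congr_deriv (by ring)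
  have hvψ : ∀ x, v x = c₄ * ψ x + (c₃ - c₂ * c₄) := fun x => by rw [hv, hψ]; ring
  have dv : ∀ x, HasDerivAt v (-(w * c₄ * φ x)) x := fun x => by
    rw [funext hvψ]
    exact (((dψ x).const_mul c₄).add_const _).congr_deriv (by ring)
  have df : ∀ x ∈ I, HasDerivAt f (m * w * c₄ * φ x / v x) x := fun x hx => by
    rw [funext hf]
    exact (((dv x).log (hvpos x hx).ne').const_mul (-m)).congr_deriv (by ring)
  have hpyth : φ t ^ 2 + ψ t ^ 2 = c₁ ^ 2 + c₂ ^ 2 := by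
    rw [hφ, hψ]
    linear_combination (c₁ ^ 2 + c₂ ^ 2) * Real.sin_sq_add_cos_sq (w * t)
  have hvp := hvpos t ht
  have hφp := hφpos t ht
  have e1 : deriv φ = fun x => w * ψ x := funext fun x => (dφ x).deriv
  have e2 : deriv (deriv φ) t = -(2 * lam) * φ t := by
    rw [e1, ((dψ t).const_mul w).deriv, ← hw2]; ring
  have e3 : deriv f t = m * w * c₄ * φ t / v t := (df t ht).deriv
  have e4 : deriv (deriv f) t = m * w * c₄ * (w * ψ t) / v t
      + m * (2 * lam) * c₄ ^ 2 * φ t ^ 2 / v t ^ 2 := by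
    have hev : deriv f =ᶠ[nhds t] fun x => m * w * c₄ * φ x / v x := by
      filter_upwards [hIopen.mem_nhds ht] with x hx using (df x hx).deriv
    rw [hev.deriv_eq]
    refine (((dφ t).const_mul (m * w * c₄)).div (dv t) hvp.ne').deriv.trans ?_
    rw [← hw2]
    field_simp
    ring
  have e5 : deriv φ t = w * ψ t := (dφ t).deriv
  have hexp : Real.exp (2 * f t / m) = 1 / v t ^ 2 := by
    have : 2 * f t / m = -(2 * Real.log (v t)) := by rw [hf]; field_simp
    rw [this, Real.exp_neg, two_mul, Real.exp_add, Real.exp_log hvp]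
    field_simp
  have hn' : (3 : ℝ) ≤ n := by exact_mod_cast hn
  have hN : (n : ℝ) + m - 1 ≠ 0 := by linarith
  have hβ' : β - ((n : ℝ) - 2) * (w * ψ t) ^ 2 = ((n : ℝ) - 2) * (2 * lam) * φ t ^ 2 := by
    rw [hβ, mul_pow, hw2, ← hpyth]; ring
  have hμ' : μ = 2 * lam * (-v t ^ 2 + 2 * c₄ * ψ t * v t + c₄ ^ 2 * φ t ^ 2) := by
    rw [hμ, hvψ]; linear_combination (-2 * lam * c₄ ^ 2) * hpyth
  refine ⟨?_, ?_, ?_⟩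
  · unfold wE1
    rw [e2, e5]
    linear_combination hβ'
  · unfold wE2
    rw [e2, e3, e4, e5, ← hw2]
    field_simp
    rw [← sub_eq_zero]
    linear_combination (((n : ℝ) - 1) * v t ^ 2) * hw2
  · unfold wE3 weightedJ
    rw [e2, e3, e4, e5, hexp, hβ', hμ']
    have hA : w * ψ t * (m * w * c₄ * φ t / v t) = 2 * lam * ψ t * m * c₄ * φ t / v t := by
      rw [← hw2]; ring
    have hB : m * w * c₄ * (w * ψ t) / v t = 2 * lam * ψ t * m * c₄ / v t := by
      rw [← hw2]; ring
    have hC : (m * w * c₄ * φ t / v t) ^ 2 = 2 * lam * m ^ 2 * c₄ ^ 2 * φ t ^ 2 / v t ^ 2 := by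
      rw [← hw2]; ring
    rw [hA, hB, hC]
    field_simp
    ring
end

section
/- Let n ≥ 3 be an integer, let m > 0 with m ≠ 1, let λ < 0, let A, B, C > 0 with A·C ≤ B, and set β = 0 and μ = −2(B − AC)²·λ. Define φ, f : ℝ → ℝ by φ(t) = A·e^{√(−2λ)·t} and f(t) = −m·log( B + AC·( e^{√(−2λ)·t} − 1 ) ). Then B + AC·(e^{√(−2λ)·t} − 1) > 0 and φ(t) > 0 for all t ∈ ℝ, and (φ, f) satisfies the weighted Einstein ODE system for (n, m, λ, μ, 0) on all of ℝ. -/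
/-- The complete family of case (3.b) of Theorem 1.3 of the paper solves the
weighted Einstein ODE system on all of ℝ with Ricci flat fiber (β = 0). -/
theorem stmt_12 (n : ℕ) (hn : 3 ≤ n) (m : ℝ) (hm : 0 < m) (hm1 : m ≠ 1)
    (lam : ℝ) (hlam : lam < 0)
    (A B C : ℝ) (hA : 0 < A) (hB : 0 < B) (hC : 0 < C) (hACB : A * C ≤ B)
    (μ : ℝ) (hμ : μ = -2 * (B - A * C) ^ 2 * lam)
    (φ f : ℝ → ℝ)
    (hφ : ∀ t, φ t = A * Real.exp (Real.sqrt (-2 * lam) * t))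
    (hf : ∀ t, f t = -m * Real.log
        (B + A * C * (Real.exp (Real.sqrt (-2 * lam) * t) - 1))) :
    (∀ t : ℝ, 0 < B + A * C * (Real.exp (Real.sqrt (-2 * lam) * t) - 1) ∧ 0 < φ t) ∧
      WeightedEinsteinODE n m lam μ 0 Set.univ φ f := by
  have hs2 : Real.sqrt (-2 * lam) ^ 2 = -2 * lam := Real.sq_sqrt (by linarith)
  generalize Real.sqrt (-2 * lam) = s at *
  obtain rfl : lam = -s ^ 2 / 2 := by linarith
  have hu : ∀ t : ℝ, 0 < B + A * C * (Real.exp (s * t) - 1) := by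
    intro t
    have h1 : 0 < A * C * Real.exp (s * t) := by positivity
    linarith
  have hE : ∀ t : ℝ, HasDerivAt (fun t => Real.exp (s * t)) (Real.exp (s * t) * s) t := by
    intro t
    have h := ((hasDerivAt_id t).const_mul s).exp
    simpa using h
  have hφ' : φ = fun t => A * Real.exp (s * t) := funext hφ
  have hf' : f = fun t => -m * Real.log (B + A * C * (Real.exp (s * t) - 1)) := funext hf
  have hU : ∀ t : ℝ, HasDerivAt (fun t => B + A * C * (Real.exp (s * t) - 1))
      (A * C * (Real.exp (s * t) * s)) t := fun t =>
    (((hE t).sub_const 1).const_mul (A * C)).const_add B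
  have d1 : deriv φ = fun t => A * (Real.exp (s * t) * s) := by
    rw [hφ']
    exact funext fun t => ((hE t).const_mul A).deriv
  have d2 : ∀ t, deriv (deriv φ) t = A * (Real.exp (s * t) * s * s) := by
    intro t
    rw [d1]
    exact (((hE t).mul_const s).const_mul A).deriv
  have e1 : deriv f = fun t => -m * (A * C * (Real.exp (s * t) * s) /
      (B + A * C * (Real.exp (s * t) - 1))) := by
    rw [hf']
    exact funext fun t => (((hU t).log (hu t).ne').const_mul (-m)).deriv
  have e2 : ∀ t, deriv (deriv f) t = -m * ((A * C * (Real.exp (s * t) * s * s) *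
      (B + A * C * (Real.exp (s * t) - 1)) - A * C * (Real.exp (s * t) * s) *
      (A * C * (Real.exp (s * t) * s))) / (B + A * C * (Real.exp (s * t) - 1)) ^ 2) := by
    intro t
    rw [e1]
    exact (((((hE t).mul_const s).const_mul (A * C)).div (hU t) (hu t).ne').const_mul (-m)).deriv
  have hexp : ∀ t, Real.exp (2 * f t / m) = 1 / (B + A * C * (Real.exp (s * t) - 1)) ^ 2 := by
    intro t
    have h : 2 * f t / m = -(Real.log (B + A * C * (Real.exp (s * t) - 1)) +
        Real.log (B + A * C * (Real.exp (s * t) - 1))) := by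
      rw [hf t]
      field_simp
      ring
    rw [h, Real.exp_neg, Real.exp_add, Real.exp_log (hu t), one_div, sq]
  refine ⟨fun t => ⟨hu t, by rw [hφ]; positivity⟩, fun t _ => ?_⟩
  have hn' : (3 : ℝ) ≤ n := by exact_mod_cast hn
  have hnm : (n : ℝ) + m - 1 ≠ 0 := by
    have : 0 < (n : ℝ) + m - 1 := by linarith
    exact this.ne'
  have hut := (hu t).ne'
  have hEt := (Real.exp_pos (s * t)).ne'
  unfold wE1 wE2 wE3 weightedJ
  rw [d2, e2, hexp, d1, e1, hφ t, hμ]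
  dsimp only
  generalize Real.exp (s * t) = E at *
  obtain ⟨u, hudef⟩ : ∃ u, u = B + A * C * (E - 1) := ⟨_, rfl⟩
  rw [← hudef] at hut ⊢
  obtain rfl : B = u - A * C * (E - 1) := by linarith
  refine ⟨by ring, ?_, ?_⟩
  · field_simp
    ring
  · field_simp
    ring
end
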